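/- arXiv:1602.08545 — 2 statements merged into one kernel-verified Lean document; each statement's English description precedes it below -/
import Mathlib

section
/- Let P(q) = ∑_{j=0}^n q^j a_j be a quaternionic polynomial of degree n (so a_n ≠ 0). If max_{|q| ≤ 1} |P'(q)| = n · max_{|q| ≤ 1} |P(q)|, then a_j = 0 for all j < n, i.e. P(q) = q^n a_n. -/
open Quaternion

/-- Orthogonality of the characters of the `N`-th roots of unity. -/
lemma sum_pow_mul_inv_pow_primitiveRoot {N : ℕ} {ζ : ℂ} (hζ : IsPrimitiveRoot ζ N) {s t : ℕ}
    (hs : s < N) (ht : t < N) :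
    ∑ k ∈ Finset.range N, (ζ ^ k) ^ s * ((ζ ^ k)⁻¹) ^ t = if s = t then (N : ℂ) else 0 := by
  have hζ0 : ζ ≠ 0 := hζ.ne_zero (by omega)
  have hterm : ∀ k, (ζ ^ k) ^ s * ((ζ ^ k)⁻¹) ^ t = (ζ ^ s * (ζ ^ t)⁻¹) ^ k := fun k => by
    rw [mul_pow, inv_pow, inv_pow, ← pow_mul, ← pow_mul, ← pow_mul, ← pow_mul, mul_comm k s,
      mul_comm k t]
  simp_rw [hterm]
  split_ifs with h
  · subst h
    simp [hζ0]
  · have hx : ζ ^ s * (ζ ^ t)⁻¹ ≠ 1 := fun hx =>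
      h (hζ.pow_inj hs ht ((mul_inv_eq_one₀ (pow_ne_zero _ hζ0)).1 hx))
    have hxN : (ζ ^ s * (ζ ^ t)⁻¹) ^ N = 1 := by
      rw [mul_pow, inv_pow, ← pow_mul, ← pow_mul, mul_comm s, mul_comm t, pow_mul, pow_mul,
        hζ.pow_eq_one]
      simp
    rw [geom_sum_eq hx, hxN, sub_self, zero_div]

/-- The Fourier coefficients of the discrete Fejér kernel. -/
lemma sum_fejer_mul_pow {n : ℕ} {ζ : ℂ} (hζ : IsPrimitiveRoot ζ (2 * n + 1)) {m : ℕ}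
    (hm : m ≤ n) :
    ∑ k ∈ Finset.range (2 * n + 1),
      ((‖∑ l ∈ Finset.range n, (ζ ^ k) ^ l‖ ^ 2 : ℝ) : ℂ) * (ζ ^ k) ^ m =
        ((2 * n + 1 : ℕ) : ℂ) * ((n - m : ℕ) : ℂ) := by
  have hnorm : ∀ k, ‖ζ ^ k‖ = 1 := fun k => by
    rw [norm_pow, hζ.norm'_eq_one (by omega), one_pow]
  have hterm : ∀ k, ((‖∑ l ∈ Finset.range n, (ζ ^ k) ^ l‖ ^ 2 : ℝ) : ℂ) * (ζ ^ k) ^ m =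
      ∑ l ∈ Finset.range n, ∑ t ∈ Finset.range n, (ζ ^ k) ^ (l + m) * ((ζ ^ k)⁻¹) ^ t := by
    intro k
    rw [Complex.ofReal_pow, ← Complex.mul_conj', map_sum, Finset.sum_mul_sum, Finset.sum_mul]
    refine Finset.sum_congr rfl fun l _ => ?_
    rw [Finset.sum_mul]
    refine Finset.sum_congr rfl fun t _ => ?_
    rw [map_pow, Complex.inv_eq_conj (hnorm k), pow_add]
    ring
  simp_rw [hterm]
  rw [Finset.sum_comm]
  have hinner : ∀ l ∈ Finset.range n,
      ∑ k ∈ Finset.range (2 * n + 1), ∑ t ∈ Finset.range n,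
        (ζ ^ k) ^ (l + m) * ((ζ ^ k)⁻¹) ^ t =
      if l ∈ Finset.range (n - m) then ((2 * n + 1 : ℕ) : ℂ) else 0 := by
    intro l hl
    rw [Finset.mem_range] at hl
    rw [Finset.sum_comm, Finset.sum_congr rfl fun t ht =>
      sum_pow_mul_inv_pow_primitiveRoot hζ (s := l + m) (t := t) (by omega)
        (by rw [Finset.mem_range] at ht; omega)]
    rw [Finset.sum_ite_eq]
    have : l + m ∈ Finset.range n ↔ l ∈ Finset.range (n - m) := by
      simp only [Finset.mem_range]; omega
    simp only [this]
  rw [Finset.sum_congr rfl hinner, ← Finset.sum_filter, Finset.sum_const, nsmul_eq_mul, mul_comm]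
  congr 3
  rw [Finset.filter_mem_eq_inter, Finset.inter_eq_right.2
    (Finset.range_mono (Nat.sub_le n m)), Finset.card_range]

/-- The discrete Fejér kernel has no zeros on the roots of unity of order `2 n + 1`. -/
lemma geom_sum_ne_zero_of_pow_eq_one {n : ℕ} (hn : n ≠ 0) {w : ℂ} (hw : w ^ (2 * n + 1) = 1) :
    ∑ l ∈ Finset.range n, w ^ l ≠ 0 := by
  intro h
  have h1 : w ^ n = 1 := by
    have := geom_sum_mul w n
    rw [h, zero_mul] at this
    exact (sub_eq_zero.1 this.symm)
  have h2 : w = 1 := by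
    rwa [pow_succ, mul_comm 2 n, pow_mul, h1, one_pow, one_mul] at hw
  subst h2
  simp [hn] at h

/-- A convex combination with positive weights of vectors of norm at most `M` has norm at least
`M` only if all vectors are equal to it. -/
lemma eq_of_norm_le_of_le_norm_sum {ι E : Type*} [NormedAddCommGroup E] [InnerProductSpace ℝ E]
    {s : Finset ι} {c : ι → ℝ} {G : ι → E} {M : ℝ} {v : E} (hc : ∀ k ∈ s, 0 < c k)
    (hc1 : ∑ k ∈ s, c k = 1) (hG : ∀ k ∈ s, ‖G k‖ ≤ M) (hv : ∑ k ∈ s, c k • G k = v)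
    (hM : M ≤ ‖v‖) : ∀ k ∈ s, G k = v := by
  have hsum : ∑ k ∈ s, c k * ‖G k - v‖ ^ 2 ≤ 0 := by
    have h1 : ∑ k ∈ s, c k * ‖G k - v‖ ^ 2 =
        ∑ k ∈ s, c k * ‖G k‖ ^ 2 - ‖v‖ ^ 2 := by
      have h2 : ∑ k ∈ s, c k * inner ℝ (G k) v = ‖v‖ ^ 2 := by
        rw [← real_inner_self_eq_norm_sq]
        nth_rewrite 2 [← hv]
        rw [sum_inner]
        simp_rw [real_inner_smul_left]
      have h3 : ∑ k ∈ s, c k * ‖G k - v‖ ^ 2 =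
          ∑ k ∈ s, c k * ‖G k‖ ^ 2 - 2 * ∑ k ∈ s, c k * inner ℝ (G k) v
            + (∑ k ∈ s, c k) * ‖v‖ ^ 2 := by
        rw [Finset.mul_sum, Finset.sum_mul, ← Finset.sum_sub_distrib, ← Finset.sum_add_distrib]
        refine Finset.sum_congr rfl fun k _ => ?_
        rw [norm_sub_sq_real]
        ring
      rw [h3, h2, hc1]
      ring
    have h4 : ∑ k ∈ s, c k * ‖G k‖ ^ 2 ≤ ∑ k ∈ s, c k * ‖v‖ ^ 2 := by
      refine Finset.sum_le_sum fun k hk => ?_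
      have := (hG k hk).trans hM
      have := (hc k hk).le
      gcongr
    rw [← Finset.sum_mul, hc1, one_mul] at h4
    linarith
  have hnn : ∀ k ∈ s, 0 ≤ c k * ‖G k - v‖ ^ 2 := fun k hk =>
    mul_nonneg (hc k hk).le (sq_nonneg _)
  intro k hk
  have h0 := (Finset.sum_eq_zero_iff_of_nonneg hnn).1 (hsum.antisymm (Finset.sum_nonneg hnn)) k hk
  have h5 := (mul_eq_zero.1 h0).resolve_left (hc k hk).ne'
  exact sub_eq_zero.1 (norm_eq_zero.1 (pow_eq_zero_iff two_ne_zero |>.1 h5))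

/-- Equality case of the Bernstein inequality for vector valued polynomials, at a point of the
unit circle. -/
lemma coeff_eq_zero_of_bernstein_eq_circle {E : Type*} [NormedAddCommGroup E]
    [InnerProductSpace ℝ E] [NormedSpace ℂ E] [IsScalarTower ℝ ℂ E] {n : ℕ} (hn : n ≠ 0)
    (a : ℕ → E) {M : ℝ}
    (hM : ∀ z : ℂ, ‖z‖ = 1 → ‖∑ j ∈ Finset.range (n + 1), z ^ j • a j‖ ≤ M)
    {z : ℂ} (hz : ‖z‖ = 1)
    (hd : n * M ≤ ‖∑ j ∈ Finset.range (n + 1), (z ^ (j - 1) * (j : ℂ)) • a j‖) :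
    ∀ j < n, a j = 0 := by
  have hz0 : z ≠ 0 := norm_ne_zero_iff.1 (by rw [hz]; exact one_ne_zero)
  have hn0 : (n : ℂ) ≠ 0 := by exact_mod_cast hn
  have hnpos : (0 : ℝ) < n := by exact_mod_cast Nat.pos_of_ne_zero hn
  obtain ⟨ζ, hζ⟩ : ∃ ζ : ℂ, IsPrimitiveRoot ζ (2 * n + 1) :=
    ⟨_, Complex.isPrimitiveRoot_exp (2 * n + 1) (by omega)⟩
  have hζ0 : ζ ≠ 0 := hζ.ne_zero (by omega)
  have hN0 : ((2 * n + 1 : ℕ) : ℂ) ≠ 0 := Nat.cast_ne_zero.2 (by omega)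
  have hnorm : ∀ k, ‖ζ ^ k‖ = 1 := fun k => by
    rw [norm_pow, hζ.norm'_eq_one (by omega), one_pow]
  set F : ℕ → ℝ := fun k => ‖∑ l ∈ Finset.range n, (ζ ^ k) ^ l‖ ^ 2 with hF
  set c : ℕ → ℝ := fun k => F k / ((2 * n + 1 : ℕ) * n) with hc
  set G : ℕ → E := fun k =>
    ∑ j ∈ Finset.range (n + 1), ((ζ ^ k) ^ (n - j) * z ^ j) • a j with hG
  have hcsum : ∀ m ≤ n, ∑ k ∈ Finset.range (2 * n + 1), (c k : ℂ) * (ζ ^ k) ^ m =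
      ((n - m : ℕ) : ℂ) / n := by
    intro m hm
    have h1 : ∀ k, (c k : ℂ) * (ζ ^ k) ^ m =
        ((F k : ℝ) : ℂ) * (ζ ^ k) ^ m / (((2 * n + 1 : ℕ) : ℂ) * n) := by
      intro k
      simp only [hc, Complex.ofReal_div, Complex.ofReal_mul, Complex.ofReal_natCast]
      ring
    simp_rw [h1]
    rw [← Finset.sum_div, sum_fejer_mul_pow hζ hm]
    field_simp
  have hcpos : ∀ k ∈ Finset.range (2 * n + 1), 0 < c k := by
    intro k _
    have h1 : ∑ l ∈ Finset.range n, (ζ ^ k) ^ l ≠ 0 := geom_sum_ne_zero_of_pow_eq_one hn (by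
      rw [← pow_mul, mul_comm, pow_mul, hζ.pow_eq_one, one_pow])
    have h2 := norm_pos_iff.2 h1
    simp only [hc, hF]
    positivity
  have hc1 : ∑ k ∈ Finset.range (2 * n + 1), c k = 1 := by
    have h := hcsum 0 (Nat.zero_le n)
    simp only [pow_zero, mul_one, Nat.sub_zero, div_self hn0] at h
    exact_mod_cast h
  have hGM : ∀ k ∈ Finset.range (2 * n + 1), ‖G k‖ ≤ M := by
    intro k _
    have h0 : ζ ^ k ≠ 0 := pow_ne_zero _ hζ0
    have h1 : G k = (ζ ^ k) ^ n •
        ∑ j ∈ Finset.range (n + 1), (z * (ζ ^ k)⁻¹) ^ j • a j := by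
      rw [hG, Finset.smul_sum]
      refine Finset.sum_congr rfl fun j hj => ?_
      rw [smul_smul, mul_pow, pow_sub₀ _ h0 (by rw [Finset.mem_range] at hj; omega), inv_pow]
      congr 1
      ring
    rw [h1, norm_smul, norm_pow, hnorm, one_pow, one_mul]
    exact hM _ (by rw [norm_mul, norm_inv, hnorm, hz, inv_one, one_mul])
  set v : E := (z / n) • ∑ j ∈ Finset.range (n + 1), (z ^ (j - 1) * (j : ℂ)) • a j with hv
  have hsum : ∑ k ∈ Finset.range (2 * n + 1), c k • G k = v := by
    have h1 : ∀ k, c k • G k = ∑ j ∈ Finset.range (n + 1),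
        (((c k : ℂ) * (ζ ^ k) ^ (n - j)) * z ^ j) • a j := by
      intro k
      rw [← algebraMap_smul ℂ (c k) (G k), hG, Finset.smul_sum]
      refine Finset.sum_congr rfl fun j _ => ?_
      rw [smul_smul, ← mul_assoc]
      rfl
    simp_rw [h1]
    rw [Finset.sum_comm, hv, Finset.smul_sum]
    refine Finset.sum_congr rfl fun j hj => ?_
    rw [← Finset.sum_smul, ← Finset.sum_mul, hcsum _ (Nat.sub_le n j), smul_smul,
      Nat.sub_sub_self (by rw [Finset.mem_range] at hj; omega)]
    congr 1
    rcases j with _ | j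
    · simp
    · rw [Nat.add_sub_cancel, pow_succ]
      ring
  have hMv : M ≤ ‖v‖ := by
    rw [hv, norm_smul, norm_div, hz, Complex.norm_natCast, one_div, ← div_eq_inv_mul,
      le_div_iff₀ hnpos, mul_comm]
    exact hd
  have hGv := eq_of_norm_le_of_le_norm_sum hcpos hc1 hGM hsum hMv
  intro j hj
  have hleft : ∑ k ∈ Finset.range (2 * n + 1), ((ζ ^ k)⁻¹) ^ (n - j) • G k =
      (((2 * n + 1 : ℕ) : ℂ) * z ^ j) • a j := by
    simp_rw [hG, Finset.smul_sum, smul_smul]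
    rw [Finset.sum_comm, Finset.sum_eq_single j]
    · rw [← Finset.sum_smul]
      simp_rw [← mul_assoc]
      rw [← Finset.sum_mul, Finset.sum_congr rfl fun k _ => mul_comm _ _,
        sum_pow_mul_inv_pow_primitiveRoot hζ (by omega) (by omega), if_pos rfl]
    · intro i hi hij
      rw [Finset.mem_range] at hi
      rw [← Finset.sum_smul]
      simp_rw [← mul_assoc]
      rw [← Finset.sum_mul, Finset.sum_congr rfl fun k _ => mul_comm _ _,
        sum_pow_mul_inv_pow_primitiveRoot hζ (by omega) (by omega), if_neg (by omega),
        zero_mul, zero_smul]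
    · intro h
      exact absurd (Finset.mem_range.2 (by omega)) h
  have hright : ∑ k ∈ Finset.range (2 * n + 1), ((ζ ^ k)⁻¹) ^ (n - j) • G k = 0 := by
    rw [Finset.sum_congr rfl fun k hk => by rw [hGv k hk], ← Finset.sum_smul]
    have h := sum_pow_mul_inv_pow_primitiveRoot hζ (s := 0) (t := n - j) (by omega) (by omega)
    simp only [pow_zero, one_mul] at h
    rw [h, if_neg (by omega), zero_smul]
  rw [hleft] at hright
  exact (smul_eq_zero.1 hright).resolve_left (mul_ne_zero hN0 (pow_ne_zero _ hz0))

/-- Equality case of the Bernstein inequality for vector valued polynomials on the unit disc. -/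
lemma coeff_eq_zero_of_bernstein_eq {E : Type*} [NormedAddCommGroup E]
    [InnerProductSpace ℝ E] [NormedSpace ℂ E] [IsScalarTower ℝ ℂ E] {n : ℕ} (hn : n ≠ 0)
    (a : ℕ → E) {M : ℝ}
    (hM : ∀ z : ℂ, ‖z‖ = 1 → ‖∑ j ∈ Finset.range (n + 1), z ^ j • a j‖ ≤ M)
    {z : ℂ} (hz : ‖z‖ ≤ 1)
    (hd : n * M ≤ ‖∑ j ∈ Finset.range (n + 1), (z ^ (j - 1) * (j : ℂ)) • a j‖) :
    ∀ j < n, a j = 0 := by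
  set f : ℂ → E := fun w => ∑ j ∈ Finset.range (n + 1), (w ^ (j - 1) * (j : ℂ)) • a j with hf
  have hdiff : Differentiable ℂ f := by
    rw [hf]
    fun_prop
  obtain ⟨w, hw, hmax⟩ := Complex.exists_mem_frontier_isMaxOn_norm
    (Metric.isBounded_ball (x := (0 : ℂ)) (r := 1)) ⟨0, by simp⟩ hdiff.diffContOnCl
  rw [frontier_ball _ one_ne_zero, mem_sphere_zero_iff_norm] at hw
  rw [closure_ball _ one_ne_zero] at hmax
  exact coeff_eq_zero_of_bernstein_eq_circle hn a hM hw
    (hd.trans (hmax (mem_closedBall_zero_iff.2 hz)))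

/-- Every quaternion lies in the isometric image of the complex plane under a homomorphism of
real algebras. -/
lemma Quaternion.exists_algHom_complex (q : ℍ[ℝ]) :
    ∃ φ : ℂ →ₐ[ℝ] ℍ[ℝ], (∀ z, ‖φ z‖ = ‖z‖) ∧ ∃ z, φ z = q := by
  obtain ⟨u, t, hu0, hu1, hq⟩ : ∃ (u : ℍ[ℝ]) (t : ℝ), u.re = 0 ∧
      u.imI ^ 2 + u.imJ ^ 2 + u.imK ^ 2 = 1 ∧ q = (q.re : ℍ[ℝ]) + t • u := by
    by_cases h : q.im = 0
    · refine ⟨⟨0, 1, 0, 0⟩, 0, rfl, by norm_num, ?_⟩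
      have hre := Quaternion.re_add_im q
      rw [h, add_zero] at hre
      exact hre.symm.trans ((add_zero _).symm.trans (congrArg _ (zero_smul ℝ _).symm))
    · have hne : ‖q.im‖ ≠ 0 := norm_ne_zero_iff.2 h
      have hsq : ‖q.im‖ ^ 2 = q.imI ^ 2 + q.imJ ^ 2 + q.imK ^ 2 := by
        rw [sq, ← Quaternion.normSq_eq_norm_mul_self, Quaternion.normSq_def']
        simp
      refine ⟨‖q.im‖⁻¹ • q.im, ‖q.im‖, by simp, ?_, ?_⟩
      · simp only [Quaternion.imI_smul, Quaternion.imJ_smul, Quaternion.imK_smul,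
          Quaternion.imI_im, Quaternion.imJ_im, Quaternion.imK_im, smul_eq_mul]
        field_simp
        exact hsq.symm
      · rw [smul_smul, mul_inv_cancel₀ hne, one_smul, Quaternion.re_add_im]
  have huu : u * u = -1 := by
    ext
    · simp [hu0]; linarith
    all_goals simp [hu0]; try ring
  refine ⟨Complex.lift ⟨u, huu⟩, fun z => ?_, ⟨q.re, t⟩, ?_⟩
  · rw [← sq_eq_sq₀ (norm_nonneg _) (norm_nonneg _), sq, ← Quaternion.normSq_eq_norm_mul_self,
      Quaternion.normSq_def', ← Complex.normSq_eq_norm_sq, Complex.normSq_apply]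
    simp [Complex.liftAux_apply, hu0]
    linear_combination z.im ^ 2 * hu1
  · rw [Complex.lift_apply, Complex.liftAux_apply]
    exact hq.symm

/-- Equality case in the Bernstein inequality for quaternionic polynomials:
if `max_{‖q‖ ≤ 1} ‖P'(q)‖ = n * max_{‖q‖ ≤ 1} ‖P(q)‖` then `P(q) = q^n a_n`,
i.e. all coefficients `a_j` with `j < n` vanish. -/
theorem bernstein_quaternion_equality (n : ℕ) (a : ℕ → ℍ[ℝ]) (han : a n ≠ 0)
    (heq : sSup {y : ℝ | ∃ q : ℍ[ℝ], ‖q‖ ≤ 1 ∧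
        y = ‖∑ j ∈ Finset.range (n + 1), q ^ (j - 1) * (j : ℍ[ℝ]) * a j‖} =
      n * sSup {y : ℝ | ∃ q : ℍ[ℝ], ‖q‖ ≤ 1 ∧
        y = ‖∑ j ∈ Finset.range (n + 1), q ^ j * a j‖}) :
    ∀ j < n, a j = 0 := by
  rcases eq_or_ne n 0 with hn | hn
  · intro j hj
    omega
  have hset : ∀ f : ℍ[ℝ] → ℝ, {y : ℝ | ∃ q : ℍ[ℝ], ‖q‖ ≤ 1 ∧ y = f q} =
      f '' Metric.closedBall 0 1 := by
    intro f
    ext y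
    simp [eq_comm]
  have : ProperSpace ℍ[ℝ] := FiniteDimensional.proper ℝ ℍ[ℝ]
  have hcompact : IsCompact (Metric.closedBall (0 : ℍ[ℝ]) 1) := isCompact_closedBall 0 1
  rw [hset, hset] at heq
  obtain ⟨q, hq, hqmax, -⟩ := hcompact.exists_sSup_image_eq_and_ge
    (f := fun q : ℍ[ℝ] => ‖∑ j ∈ Finset.range (n + 1), q ^ (j - 1) * (j : ℍ[ℝ]) * a j‖)
    ⟨0, by simp⟩ (by fun_prop)
  have hbdd := (hcompact.image_of_continuousOn
    (f := fun q : ℍ[ℝ] => ‖∑ j ∈ Finset.range (n + 1), q ^ j * a j‖) (by fun_prop)).bddAbove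
  rw [hqmax] at heq
  obtain ⟨φ, hφ, z, rfl⟩ := Quaternion.exists_algHom_complex q
  let _ : Module ℂ ℍ[ℝ] := Module.compHom ℍ[ℝ] φ.toRingHom
  have hsmul : ∀ (w : ℂ) (x : ℍ[ℝ]), w • x = φ w * x := fun _ _ => rfl
  let _ : NormedSpace ℂ ℍ[ℝ] :=
    { norm_smul_le := fun w x => by rw [hsmul, norm_mul, hφ] }
  have : IsScalarTower ℝ ℂ ℍ[ℝ] := ⟨fun r w x => by
    rw [hsmul, hsmul, map_smul, smul_mul_assoc]⟩
  refine coeff_eq_zero_of_bernstein_eq hn a (fun w hw => ?_)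
    (z := z) (by rw [← hφ]; exact mem_closedBall_zero_iff.1 hq) (heq.symm.trans ?_).le
  · refine le_trans (le_of_eq ?_)
      (le_csSup hbdd ⟨φ w, mem_closedBall_zero_iff.2 (by rw [hφ, hw]), rfl⟩)
    simp only [hsmul, map_pow]
  · simp only [hsmul, map_mul, map_pow, map_natCast]
end

section
/- Let P(q) = ∑_{j=0}^n q^j a_j be a quaternionic polynomial of degree n ≥ 1 (so a_n ≠ 0) such that P(1) = 1, max_{|q| ≤ 1} |P(q)| = 1, and for some δ > 1 one has max_{|q| = R} |P(q)| ≤ (1 + R^n)/2 for every R with 1 < R < δ. Then it is not the case that every zero of P lies in the open unit ball, i.e. ¬(∀ q ∈ ℍ, P(q) = 0 → |q| < 1). -/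
open Quaternion

open Polynomial

theorem exists_pow_eq_smul_add_smul (u v : ℝ) : ∃ s t : ℕ → ℝ,
    ∀ {A : Type} [Ring A] [Algebra ℝ A] (q : A), q * q = u • q - v • (1 : A) →
      ∀ j, q ^ j = s j • q + t j • (1 : A) := by
  let f : ℕ → ℝ × ℝ := fun j =>
    Nat.rec (0, 1) (fun _ r => (u * r.1 + r.2, -(v * r.1))) j
  refine ⟨fun j => (f j).1, fun j => (f j).2, fun q hq j => ?_⟩
  induction j with
  | zero => simp [f]
  | succ j ih =>
    have h1 : (f (j + 1)).1 = u * (f j).1 + (f j).2 := rfl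
    have h2 : (f (j + 1)).2 = -(v * (f j).1) := rfl
    simp only [h1, h2]
    rw [pow_succ, ih, add_mul, smul_mul_assoc, hq, smul_mul_assoc, one_mul]
    module

/-- The real polynomial obtained by applying a linear functional to the first `n + 1`
quaternionic coefficients. -/
noncomputable def componentPoly (a : ℕ → ℍ[ℝ]) (n : ℕ) (φ : ℍ[ℝ] →ₗ[ℝ] ℝ) : ℝ[X] :=
  ∑ j ∈ Finset.range (n + 1), C (φ (a j)) * X ^ j

theorem natDegree_componentPoly_le (a : ℕ → ℍ[ℝ]) (n : ℕ) (φ : ℍ[ℝ] →ₗ[ℝ] ℝ) :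
    (componentPoly a n φ).natDegree ≤ n :=
  natDegree_sum_le_of_forall_le _ _ fun _ hj =>
    (natDegree_C_mul_X_pow_le _ _).trans (Nat.lt_succ_iff.1 (Finset.mem_range.1 hj))

theorem coeff_componentPoly (a : ℕ → ℍ[ℝ]) (n : ℕ) (φ : ℍ[ℝ] →ₗ[ℝ] ℝ) :
    (componentPoly a n φ).coeff n = φ (a n) := by
  simp [componentPoly, coeff_X_pow]

theorem eval_componentPoly (a : ℕ → ℍ[ℝ]) (n : ℕ) (φ : ℍ[ℝ] →ₗ[ℝ] ℝ) (x : ℝ) :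
    (componentPoly a n φ).eval x =
      φ (∑ j ∈ Finset.range (n + 1), (x : ℍ[ℝ]) ^ j * a j) := by
  simp only [componentPoly, eval_finsetSum, map_sum]
  refine Finset.sum_congr rfl fun j _ => ?_
  rw [← Quaternion.coe_pow, Quaternion.coe_mul_eq_smul, map_smul, eval_mul, eval_C, eval_pow,
    eval_X, smul_eq_mul, mul_comm]

theorem aeval_componentPoly (a : ℕ → ℍ[ℝ]) (n : ℕ) (φ : ℍ[ℝ] →ₗ[ℝ] ℝ) (z : ℂ) (s t : ℕ → ℝ)
    (h : ∀ j, z ^ j = s j • z + t j • (1 : ℂ)) :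
    aeval z (componentPoly a n φ) =
      z * φ (∑ j ∈ Finset.range (n + 1), s j • a j) +
        φ (∑ j ∈ Finset.range (n + 1), t j • a j) := by
  simp only [componentPoly, map_sum, map_smul, Complex.ofReal_sum, Finset.mul_sum,
    ← Finset.sum_add_distrib]
  refine Finset.sum_congr rfl fun j _ => ?_
  simp [h]
  ring

/-- The four real components of a quaternion, as linear functionals. -/
noncomputable def component (i : Fin 4) : ℍ[ℝ] →ₗ[ℝ] ℝ where
  toFun q := ![q.re, q.imI, q.imJ, q.imK] i
  map_add' p q := by fin_cases i <;> simp
  map_smul' r q := by fin_cases i <;> simp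

theorem component_apply (i : Fin 4) (q : ℍ[ℝ]) :
    component i q = ![q.re, q.imI, q.imJ, q.imK] i := rfl

theorem sum_component_mul_self (q : ℍ[ℝ]) :
    ∑ i, component i q * component i q = Quaternion.normSq q := by
  rw [Quaternion.normSq_def']
  simp [Fin.sum_univ_four, component_apply, sq]

/-- The symmetrization of a quaternionic polynomial: the real polynomial whose value at a real
number is the squared modulus of the quaternionic one. -/
noncomputable def symmetrization (a : ℕ → ℍ[ℝ]) (n : ℕ) : ℝ[X] :=
  ∑ i, componentPoly a n (component i) * componentPoly a n (component i)

theorem eval_symmetrization (a : ℕ → ℍ[ℝ]) (n : ℕ) (x : ℝ) :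
    (symmetrization a n).eval x =
      ‖∑ j ∈ Finset.range (n + 1), (x : ℍ[ℝ]) ^ j * a j‖ ^ 2 := by
  rw [sq, ← Quaternion.normSq_eq_norm_mul_self, ← sum_component_mul_self]
  simp only [symmetrization, eval_finsetSum, eval_mul, eval_componentPoly]

theorem natDegree_symmetrization (a : ℕ → ℍ[ℝ]) (n : ℕ) (han : a n ≠ 0) :
    (symmetrization a n).natDegree = n + n := by
  have hd := natDegree_componentPoly_le a n
  refine natDegree_eq_of_le_of_coeff_ne_zero ?_ ?_
  · exact natDegree_sum_le_of_forall_le _ _ fun i _ => natDegree_mul_le_of_le (hd _) (hd _)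
  · simp only [symmetrization, finsetSum_coeff, coeff_mul_add_eq_of_natDegree_le (hd _) (hd _),
      coeff_componentPoly, sum_component_mul_self]
    exact Quaternion.normSq_ne_zero.2 han

theorem exists_zero_of_aeval_symmetrization_eq_zero (a : ℕ → ℍ[ℝ]) (n : ℕ) (z : ℂ)
    (hz : aeval z (symmetrization a n) = 0) :
    ∃ q : ℍ[ℝ], ∑ j ∈ Finset.range (n + 1), q ^ j * a j = 0 ∧ ‖q‖ = ‖z‖ := by
  obtain ⟨s, t, hst⟩ := exists_pow_eq_smul_add_smul (2 * z.re) (Complex.normSq z)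
  have hpow := hst z (by
    apply Complex.ext <;> simp [Complex.normSq_apply] <;> ring)
  set b : ℍ[ℝ] := ∑ j ∈ Finset.range (n + 1), s j • a j with hb
  set c : ℍ[ℝ] := ∑ j ∈ Finset.range (n + 1), t j • a j with hc
  have key (q : ℍ[ℝ]) (hre : q.re = z.re) (hn : Quaternion.normSq q = Complex.normSq z)
      (h0 : q * b + c = 0) :
      ∃ q : ℍ[ℝ], ∑ j ∈ Finset.range (n + 1), q ^ j * a j = 0 ∧ ‖q‖ = ‖z‖ := by
    refine ⟨q, ?_, ?_⟩
    · have hq := hst q (by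
        rw [← hre, ← hn, Quaternion.normSq_def']
        ext <;> simp <;> ring)
      rw [← h0, hb, hc, Finset.mul_sum, ← Finset.sum_add_distrib]
      refine Finset.sum_congr rfl fun j _ => ?_
      rw [hq, add_mul, smul_mul_assoc, smul_mul_assoc, one_mul, mul_smul_comm]
    · rw [Quaternion.normSq_eq_norm_mul_self, Complex.normSq_eq_norm_sq, ← sq] at hn
      exact (pow_left_inj₀ (norm_nonneg _) (norm_nonneg _) two_ne_zero).1 hn
  simp only [symmetrization, Fin.sum_univ_four, map_add (aeval z), map_mul (aeval z),
    aeval_componentPoly a n _ z s t hpow, ← hb, ← hc, component_apply] at hz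
  clear_value b c
  have hz1 := congrArg Complex.re hz
  have hz2 := congrArg Complex.im hz
  simp at hz1 hz2
  by_cases hy : z.im = 0
  · refine key (z.re : ℍ[ℝ]) (by simp) (by
      simp [Complex.normSq_apply, hy, Quaternion.normSq_coe, sq]) ?_
    rw [← Quaternion.normSq_eq_zero, Quaternion.normSq_def']
    simp [hy] at hz1 ⊢
    linarith
  · have hbc : b.re * c.re + b.imI * c.imI + b.imJ * c.imJ + b.imK * c.imK
        = - z.re * Quaternion.normSq b := by
      rw [Quaternion.normSq_def']
      apply mul_left_cancel₀ hy
      linarith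
    have hcc : Quaternion.normSq c = Complex.normSq z * Quaternion.normSq b := by
      rw [Quaternion.normSq_def'] at hbc
      rw [Quaternion.normSq_def', Quaternion.normSq_def', Complex.normSq_apply]
      linear_combination hz1 - 2 * z.re * hbc
    by_cases hb0 : b = 0
    · have hc0 : c = 0 := by simpa [hb0] using hcc
      exact key ⟨z.re, z.im, 0, 0⟩ rfl
        ((Quaternion.normSq_def' _).trans (by simp [Complex.normSq_apply, sq]))
        (by rw [hb0, hc0]; exact (add_zero _).trans (mul_zero _))
    · have hnb := Quaternion.normSq_ne_zero.2 hb0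
      refine key (-(c * b⁻¹)) ?_ ?_ (by simp [hb0])
      · rw [Quaternion.inv_def]
        apply mul_right_cancel₀ hnb
        simp
        field_simp
        linarith
      · rw [Quaternion.normSq_neg, map_mul, map_inv₀, hcc, mul_assoc, mul_inv_cancel₀ hnb, mul_one]

theorem half_lt_re_one_div_one_sub {w : ℂ} (hw : ‖w‖ < 1) : 1 / 2 < (1 / (1 - w)).re := by
  have h : Complex.normSq w < 1 := by
    rw [Complex.normSq_eq_norm_sq]; nlinarith [norm_nonneg w]
  have h0 : 0 < Complex.normSq (1 - w) := by
    rw [Complex.normSq_pos, sub_ne_zero]; rintro rfl; simp at hw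
  rw [one_div (1 - w), Complex.inv_re, div_lt_div_iff₀ two_pos h0]
  simp only [Complex.normSq_apply, Complex.sub_re, Complex.sub_im, Complex.one_re,
    Complex.one_im] at h ⊢
  nlinarith

/-- A real polynomial with all complex roots in the open unit disc has large logarithmic
derivative at `1`. -/
theorem natDegree_lt_two_mul_eval_derivative {p : ℝ[X]} (hd : 0 < p.natDegree)
    (h1 : p.eval 1 = 1) (hroots : ∀ z : ℂ, aeval z p = 0 → ‖z‖ < 1) :
    (p.natDegree : ℝ) < 2 * p.derivative.eval 1 := by
  set P : ℂ[X] := p.map (algebraMap ℝ ℂ) with hP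
  have hs : P.Splits := IsAlgClosed.splits P
  have hev (r : ℝ[X]) : (r.map (algebraMap ℝ ℂ)).eval 1 = (r.eval 1 : ℝ) := by
    simpa using eval_map_apply (f := algebraMap ℝ ℂ) (p := r) 1
  have e1 : P.eval 1 = 1 := by rw [hP, hev, h1, Complex.ofReal_one]
  have hlog := hs.eval_derivative_div_eval_of_ne_zero (x := 1) (by simp [e1])
  rw [e1, div_one, hP, derivative_map, hev, ← hP] at hlog
  have hcard : P.roots.card = p.natDegree := by
    rw [← hs.natDegree_eq_card_roots, hP, natDegree_map]
  have hre := congrArg Complex.reAddGroupHom hlog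
  rw [map_multiset_sum, Multiset.map_map] at hre
  have hlt : (P.roots.map fun _ => (1 / 2 : ℝ)).sum <
      (P.roots.map (Complex.reAddGroupHom ∘ fun z => 1 / (1 - z))).sum := by
    refine Multiset.sum_lt_sum_of_nonempty ?_ fun z hz => ?_
    · exact Multiset.card_pos.1 (hcard ▸ hd)
    · refine half_lt_re_one_div_one_sub (hroots z ?_)
      rw [← eval_map_algebraMap]
      exact (mem_roots'.1 hz).2
  rw [← hre, Multiset.map_const', Multiset.sum_replicate, hcard, nsmul_eq_mul] at hlt
  have : Complex.reAddGroupHom ((p.derivative.eval 1 : ℝ) : ℂ) = p.derivative.eval 1 := rfl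
  linarith

/-- If `f ≤ g` to the right of a point where they agree, their derivatives compare there. -/
theorem HasDerivAt.le_of_forall_Ioo_le {f g : ℝ → ℝ} {f' g' x y : ℝ} (hf : HasDerivAt f f' x)
    (hg : HasDerivAt g g' x) (hxy : x < y) (heq : f x = g x)
    (hle : ∀ r, x < r → r < y → f r ≤ g r) : f' ≤ g' := by
  have h := ((hg.sub hf).hasDerivWithinAt (s := Set.Ioi x))
  rw [hasDerivWithinAt_iff_tendsto_slope' (by simp)] at h
  refine sub_nonneg.1 (ge_of_tendsto h ?_)
  filter_upwards [Ioo_mem_nhdsGT hxy] with r hr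
  rw [slope_def_field]
  have := hle r hr.1 hr.2
  have := hr.1
  apply div_nonneg <;> simp <;> linarith

/-- Converse Ankeny–Rivlin result in the quaternionic setting: if a quaternionic
polynomial `P` of degree `n ≥ 1` satisfies `P(1) = 1`, `max_{‖q‖ ≤ 1} ‖P(q)‖ = 1`,
and `max_{‖q‖ = R} ‖P(q)‖ ≤ (1 + Rⁿ)/2` for all `1 < R < δ` (for some `δ > 1`),
then not all zeros of `P` lie in the open unit ball. -/
theorem ankeny_rivlin_converse_quaternion (n : ℕ) (hn : 1 ≤ n)
    (a : ℕ → ℍ[ℝ]) (han : a n ≠ 0)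
    (P : ℍ[ℝ] → ℍ[ℝ]) (hP : ∀ q, P q = ∑ j ∈ Finset.range (n + 1), q ^ j * a j)
    (h1 : P 1 = 1)
    (hmax : sSup {y : ℝ | ∃ q : ℍ[ℝ], ‖q‖ ≤ 1 ∧ y = ‖P q‖} = 1)
    (δ : ℝ) (hδ : 1 < δ)
    (hR : ∀ R : ℝ, 1 < R → R < δ →
        sSup {y : ℝ | ∃ q : ℍ[ℝ], ‖q‖ = R ∧ y = ‖P q‖} ≤ (1 + R ^ n) / 2) :
    ¬ (∀ q : ℍ[ℝ], P q = 0 → ‖q‖ < 1) := by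
  intro hzero
  have hN1 : (symmetrization a n).eval 1 = 1 := by
    have := eval_symmetrization a n 1
    rw [← hP, Quaternion.coe_one, h1] at this
    simpa using this
  have hdeg := natDegree_symmetrization a n han
  have hlow : ((symmetrization a n).natDegree : ℝ) <
      2 * (symmetrization a n).derivative.eval 1 := by
    refine natDegree_lt_two_mul_eval_derivative (by omega) hN1 fun z hz => ?_
    obtain ⟨q, hq, hqz⟩ := exists_zero_of_aeval_symmetrization_eq_zero a n z hz
    exact hqz ▸ hzero q ((hP q).trans hq)
  have hcont : Continuous P := by
    rw [funext hP]; fun_prop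
  have hbound (r : ℝ) (hr : 1 < r) (hrδ : r < δ) :
      (symmetrization a n).eval r ≤ ((1 + r ^ n) / 2) ^ 2 := by
    rw [eval_symmetrization, ← hP]
    refine pow_le_pow_left₀ (norm_nonneg _) ((le_csSup ?_ ?_).trans (hR r hr hrδ)) 2
    · refine ((isCompact_sphere (0 : ℍ[ℝ]) r).bddAbove_image hcont.norm.continuousOn).mono ?_
      rintro _ ⟨q, hq, rfl⟩
      exact ⟨q, by simpa using hq, rfl⟩
    · exact ⟨r, by rw [Quaternion.norm_coe, Real.norm_of_nonneg (by linarith)], rfl⟩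
  have hup : (symmetrization a n).derivative.eval 1 ≤ n := by
    have hg : HasDerivAt (fun r : ℝ => ((1 + r ^ n) / 2) ^ 2) (n : ℝ) 1 := by
      refine ((((hasDerivAt_pow n (1 : ℝ)).const_add 1).div_const 2).pow 2).congr_deriv ?_
      simp only [one_pow, mul_one]
      norm_num
      ring
    exact ((symmetrization a n).hasDerivAt 1).le_of_forall_Ioo_le hg hδ (by norm_num [hN1]) hbound
  rw [hdeg] at hlow
  push_cast at hlow
  linarith
end
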